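/- arXiv:1004.1936 — 2 statements merged into one kernel-verified Lean document; each statement's English description precedes it below -/
import Mathlib

section
/- Let A ∈ M_n(ℂ) be such that its first n−1 rows are linearly independent and e_n·e_n = b (e_1·e_1) for some b ∈ ℂ with b ≠ 0. Let d be a derivation of E(A) with matrix entries d_{ij}. Then the characteristic polynomial of d equals ((X − d_{11})² + b·d_{1n}²) · ∏_{i=2}^{n−1} (X − d_{ii}); in particular, the eigenvalues of d are d_{22}, …, d_{n−1,n−1}, d_{11}+δ, d_{11}−δ, where δ ∈ ℂ satisfies δ² = −b·d_{1n}². -/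
open Matrix Polynomial Finset

/-- The multiplication of the evolution algebra `E(A)` on `ℂ^n` associated to the
matrix `A`: it is the unique commutative bilinear multiplication with
`e i · e j = 0` for `i ≠ j` and `e i · e i = ∑ k, A i k • e k`, where `e i = Pi.single i 1`
is the standard (natural) basis. -/
noncomputable def evolMul {n : ℕ} (A : Matrix (Fin n) (Fin n) ℂ) (u v : Fin n → ℂ) : Fin n → ℂ :=
  fun k => ∑ i, u i * v i * A i k

/-- A linear map `d : E(A) → E(A)` is a derivation if `d (u·v) = d u · v + u · d v`. -/
def IsEvolDerivation {n : ℕ} (A : Matrix (Fin n) (Fin n) ℂ)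
    (d : (Fin n → ℂ) →ₗ[ℂ] (Fin n → ℂ)) : Prop :=
  ∀ u v : Fin n → ℂ, d (evolMul A u v) = evolMul A (d u) v + evolMul A u (d v)

/-- The determinant of a matrix that is diagonal apart from a `2 × 2` block at the indices
`a` and `c`. -/
theorem det_of_diagonal_off_pair {ι R : Type*} [Fintype ι] [DecidableEq ι] [CommRing R]
    (M : Matrix ι ι R) {a c : ι} (hac : a ≠ c)
    (hM : ∀ i j, i ≠ j → ¬(i = a ∧ j = c) → ¬(i = c ∧ j = a) → M i j = 0) :
    M.det = (M a a * M c c - M a c * M c a)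
      * ∏ i ∈ Finset.univ.filter (fun i => i ≠ a ∧ i ≠ c), M i i := by
  rw [Matrix.twoBlockTriangular_det M (fun i => i ≠ a ∧ i ≠ c), mul_comm]
  · congr 1
    · let f : Fin 2 → {i // ¬(i ≠ a ∧ i ≠ c)} := ![⟨a, by simp⟩, ⟨c, by simp⟩]
      have hf : Function.Bijective f := by
        constructor
        · intro x y h
          fin_cases x <;> fin_cases y <;> simp_all [f, hac.symm]
        · rintro ⟨x, hx⟩
          by_cases hxa : x = a
          · exact ⟨0, by simp [f, hxa]⟩
          · exact ⟨1, by simp only [f]; ext; simp; tauto⟩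
      rw [← Matrix.det_submatrix_equiv_self (Equiv.ofBijective f hf), Matrix.det_fin_two]
      simp [f, Matrix.toSquareBlockProp]
    · have hdiag : M.toSquareBlockProp (fun i => i ≠ a ∧ i ≠ c)
          = Matrix.diagonal fun i : {i // i ≠ a ∧ i ≠ c} => M i i := by
        ext i j
        by_cases hij : i = j
        · subst hij; simp [Matrix.toSquareBlockProp]
        · rw [Matrix.diagonal_apply_ne _ hij]
          exact hM _ _ (fun h => hij (Subtype.ext h)) (fun h => i.2.1 h.1) (fun h => i.2.2 h.1)
      rw [hdiag, Matrix.det_diagonal]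
      exact (Finset.prod_subtype _ (by simp) fun i => M i i).symm
  · intro i hi j hj
    exact hM _ _ (fun h => hi (h ▸ hj)) (fun h => hj.2 h.2) (fun h => hj.1 h.2)

/-- Multiplication by a basis vector in an evolution algebra. -/
theorem evolMul_single {n : ℕ} (A : Matrix (Fin n) (Fin n) ℂ) (u : Fin n → ℂ) (j : Fin n) :
    evolMul A u (Pi.single j 1) = u j • A j := by
  ext k
  simp [evolMul, Pi.single_apply]

theorem single_evolMul {n : ℕ} (A : Matrix (Fin n) (Fin n) ℂ) (u : Fin n → ℂ) (j : Fin n) :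
    evolMul A (Pi.single j 1) u = u j • A j := by
  ext k
  simp [evolMul, Pi.single_apply]

namespace IsEvolDerivation

variable {n : ℕ} {A : Matrix (Fin n) (Fin n) ℂ} {d : (Fin n → ℂ) →ₗ[ℂ] (Fin n → ℂ)}

theorem smul_add_smul_eq_zero (hd : IsEvolDerivation A d) {i j : Fin n} (hij : i ≠ j) :
    d (Pi.single i 1) j • A j + d (Pi.single j 1) i • A i = 0 := by
  have h := hd (Pi.single i 1) (Pi.single j 1)
  rw [evolMul_single, evolMul_single, single_evolMul, Pi.single_eq_of_ne hij.symm, zero_smul,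
    map_zero] at h
  exact h.symm

theorem map_row (hd : IsEvolDerivation A d) (i : Fin n) :
    d (A i) = (2 * d (Pi.single i 1) i) • A i := by
  have h := hd (Pi.single i 1) (Pi.single i 1)
  rw [evolMul_single, evolMul_single, single_evolMul, Pi.single_eq_same, one_smul] at h
  rw [h, two_mul, add_smul]

theorem apply_eq_zero (hd : IsEvolDerivation A d) {i j : Fin n} (hij : i ≠ j)
    (hA : LinearIndependent ℂ ![A i, A j]) : d (Pi.single i 1) j = 0 := by
  rw [LinearIndependent.pair_iff] at hA
  exact (hA _ _ ((add_comm _ _).trans (hd.smul_add_smul_eq_zero hij))).2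

end IsEvolDerivation

/-- Suppose the first `n-1` rows of `A` are linearly independent and
`eₙ·eₙ = b (e₁·e₁)` with `b ≠ 0`.  Then the characteristic polynomial of a derivation `d`
of `E(A)` equals `((X - d₁₁)² + b d₁ₙ²) ∏_{i=2}^{n-1} (X - dᵢᵢ)`; in particular, for
`δ` with `δ² = -b d₁ₙ²`, the eigenvalues of `d` are exactly
`d₂₂, …, d_{n-1,n-1}, d₁₁ + δ, d₁₁ - δ`. -/
theorem derivation_charpoly (n : ℕ) (hn : 3 ≤ n)
    (A : Matrix (Fin n) (Fin n) ℂ)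
    (hrows : LinearIndependent ℂ (fun i : Fin (n - 1) => A (Fin.castLE (Nat.sub_le n 1) i)))
    (b : ℂ) (hb : b ≠ 0)
    (hlast : evolMul A (Pi.single (⟨n - 1, by omega⟩ : Fin n) 1)
        (Pi.single (⟨n - 1, by omega⟩ : Fin n) 1)
      = b • evolMul A (Pi.single (⟨0, by omega⟩ : Fin n) 1)
          (Pi.single (⟨0, by omega⟩ : Fin n) 1))
    (d : (Fin n → ℂ) →ₗ[ℂ] (Fin n → ℂ)) (hd : IsEvolDerivation A d) :
    (Matrix.charpoly (Matrix.of fun i j : Fin n => d (Pi.single i 1) j)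
        = ((X - C (d (Pi.single (⟨0, by omega⟩ : Fin n) 1) (⟨0, by omega⟩ : Fin n))) ^ 2
              + C (b * d (Pi.single (⟨0, by omega⟩ : Fin n) 1) (⟨n - 1, by omega⟩ : Fin n) ^ 2))
            * ∏ i ∈ Finset.univ.filter (fun i : Fin n => 0 < i.val ∧ i.val < n - 1),
                (X - C (d (Pi.single i 1) i))) ∧
      ∀ δ : ℂ,
        δ ^ 2 = -(b * d (Pi.single (⟨0, by omega⟩ : Fin n) 1) (⟨n - 1, by omega⟩ : Fin n) ^ 2) →
        spectrum ℂ (d : Module.End ℂ (Fin n → ℂ))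
          = {x : ℂ | (∃ i : Fin n, 0 < i.val ∧ i.val < n - 1 ∧ x = d (Pi.single i 1) i)
              ∨ x = d (Pi.single (⟨0, by omega⟩ : Fin n) 1) (⟨0, by omega⟩ : Fin n) + δ
              ∨ x = d (Pi.single (⟨0, by omega⟩ : Fin n) 1) (⟨0, by omega⟩ : Fin n) - δ} := by
  have hlt : n - 1 < n := by omega
  have h0 : 0 < n := by omega
  set z : Fin n := ⟨0, h0⟩ with hz
  set l : Fin n := ⟨n - 1, hlt⟩ with hl
  have hzl : z ≠ l := by simp only [hz, hl, ne_eq, Fin.mk.injEq]; omega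
  have hAl : A l = b • A z := by
    simpa [evolMul_single] using hlast
  have hpair : ∀ i j : Fin n, i ≠ j → i ≠ l → j ≠ l → LinearIndependent ℂ ![A i, A j] := by
    intro i j hij hil hjl
    have hi : i.val < n - 1 := by
      have := i.2; have : i.val ≠ n - 1 := fun h => hil (Fin.ext h); omega
    have hj : j.val < n - 1 := by
      have := j.2; have : j.val ≠ n - 1 := fun h => hjl (Fin.ext h); omega
    have h := hrows.comp ![(⟨i, hi⟩ : Fin (n - 1)), ⟨j, hj⟩] (by
      have : i.val ≠ j.val := fun h => hij (Fin.ext h)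
      intro x y h
      fin_cases x <;> fin_cases y <;> simp_all [this.symm])
    convert h using 1
    ext x : 1
    fin_cases x <;> rfl
  have hAz : A z ≠ 0 := hrows.ne_zero (⟨0, by omega⟩ : Fin (n - 1))
  have hpairl : ∀ i : Fin n, i ≠ z → i ≠ l → LinearIndependent ℂ ![A i, A l] := by
    intro i hiz hil
    have h := hpair i z hiz hil hzl
    rw [LinearIndependent.pair_iff] at h ⊢
    intro s t hst
    rw [hAl, smul_smul] at hst
    obtain ⟨h1, h2⟩ := h _ _ hst
    exact ⟨h1, (mul_eq_zero.mp h2).resolve_right hb⟩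
  have hoff : ∀ i j : Fin n, i ≠ j → ¬(i = z ∧ j = l) → ¬(i = l ∧ j = z) →
      d (Pi.single i 1) j = 0 := by
    intro i j hij h1 h2
    refine hd.apply_eq_zero hij ?_
    by_cases hil : i = l
    · subst hil
      exact LinearIndependent.pair_symm_iff.mp (hpairl j (fun h => h2 ⟨rfl, h⟩) hij.symm)
    · by_cases hjl : j = l
      · subst hjl
        exact hpairl i (fun h => h1 ⟨h, rfl⟩) hil
      · exact hpair i j hij hil hjl
  have hcorner : d (Pi.single l 1) z = -(b * d (Pi.single z 1) l) := by
    have h := hd.smul_add_smul_eq_zero hzl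
    rw [hAl, smul_smul, ← add_smul] at h
    linear_combination (smul_eq_zero.mp h).resolve_right hAz
  have hdiag : d (Pi.single l 1) l = d (Pi.single z 1) z := by
    have h := hd.map_row l
    rw [hAl, map_smul, hd.map_row z, smul_smul, smul_smul, ← sub_eq_zero, ← sub_smul] at h
    have h' := (smul_eq_zero.mp h).resolve_right hAz
    apply mul_left_cancel₀ hb
    linear_combination -h' / 2
  have hfilter : Finset.univ.filter (fun i : Fin n => 0 < i.val ∧ i.val < n - 1)
      = Finset.univ.filter (fun i : Fin n => i ≠ z ∧ i ≠ l) := by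
    ext i
    have := i.2
    simp only [Finset.mem_filter, Finset.mem_univ, true_and, hz, hl, ne_eq, Fin.ext_iff]
    omega
  have hchar : Matrix.charpoly (Matrix.of fun i j : Fin n => d (Pi.single i 1) j)
      = ((X - C (d (Pi.single z 1) z)) ^ 2 + C (b * d (Pi.single z 1) l ^ 2))
          * ∏ i ∈ Finset.univ.filter (fun i : Fin n => 0 < i.val ∧ i.val < n - 1),
              (X - C (d (Pi.single i 1) i)) := by
    rw [Matrix.charpoly, det_of_diagonal_off_pair _ hzl, hfilter]
    · simp only [Matrix.charmatrix_apply_eq, Matrix.charmatrix_apply_ne _ _ _ hzl,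
        Matrix.charmatrix_apply_ne _ _ _ hzl.symm, Matrix.of_apply, hcorner, hdiag]
      congr 1
      simp only [map_neg, map_mul, map_pow]
      ring
    · intro i j hij h1 h2
      simp [Matrix.charmatrix_apply_ne _ _ _ hij, hoff i j hij h1 h2]
  refine ⟨hchar, fun δ hδ => ?_⟩
  have hcharpoly : d.charpoly
      = Matrix.charpoly (Matrix.of fun i j : Fin n => d (Pi.single i 1) j) := by
    rw [← LinearMap.charpoly_toMatrix d (Pi.basisFun ℂ (Fin n)), ← Matrix.charpoly_transpose]
    congr 1
  ext x
  rw [← Module.End.hasEigenvalue_iff_mem_spectrum, Module.End.hasEigenvalue_iff_isRoot_charpoly,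
    hcharpoly, hchar, Polynomial.IsRoot.def, eval_mul, mul_eq_zero, eval_prod,
    Finset.prod_eq_zero_iff, or_comm]
  refine or_congr ?_ ?_
  · simp [sub_eq_zero, and_assoc]
  · have hfac : eval x ((X - C (d (Pi.single z 1) z)) ^ 2 + C (b * d (Pi.single z 1) l ^ 2))
        = (x - (d (Pi.single z 1) z + δ)) * (x - (d (Pi.single z 1) z - δ)) := by
      simp only [eval_add, eval_pow, eval_sub, eval_X, eval_C]
      linear_combination hδ
    rw [hfac, mul_eq_zero, sub_eq_zero, sub_eq_zero]
end

section
/- Let A ∈ M_n(ℂ) be such that its first n−1 rows are linearly independent, its n-th row is zero (i.e. e_n·e_n = 0), and let d be a derivation of E(A) with matrix entries d_{ij}. Then d_{nj} = 0 for all 1 ≤ j ≤ n−1. -/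
open Matrix Polynomial Finset

/-- Multiplying by `eⱼ` on the left picks out the `j`-th coordinate times the `j`-th row. -/
lemma evolMul_single_left {n : ℕ} (A : Matrix (Fin n) (Fin n) ℂ) (j : Fin n) (v : Fin n → ℂ) :
    evolMul A (Pi.single j 1) v = v j • A j := by
  ext k
  simp [evolMul, Pi.single_apply]

/-- Multiplying by `eⱼ` on the right picks out the `j`-th coordinate times the `j`-th row. -/
lemma evolMul_single_right {n : ℕ} (A : Matrix (Fin n) (Fin n) ℂ) (j : Fin n) (u : Fin n → ℂ) :
    evolMul A u (Pi.single j 1) = u j • A j := by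
  ext k
  simp [evolMul, Pi.single_apply]

/-- Suppose the first `n-1` rows of `A` are linearly independent and the `n`-th row is
zero (i.e. `eₙ·eₙ = 0`).  Then any derivation `d` of `E(A)` satisfies `dₙⱼ = 0` for all
`1 ≤ j ≤ n-1`. -/
theorem derivation_last_row_of_zero_last_row (n : ℕ) (hn : 2 ≤ n)
    (A : Matrix (Fin n) (Fin n) ℂ)
    (hrows : LinearIndependent ℂ (fun i : Fin (n - 1) => A (Fin.castLE (Nat.sub_le n 1) i)))
    (hzero : A (⟨n - 1, by omega⟩ : Fin n) = 0)
    (d : (Fin n → ℂ) →ₗ[ℂ] (Fin n → ℂ)) (hd : IsEvolDerivation A d) :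
    ∀ j : Fin n, j.val < n - 1 → d (Pi.single (⟨n - 1, by omega⟩ : Fin n) 1) j = 0 := by
  intro j hj
  have h := hd (Pi.single j 1) (Pi.single (⟨n - 1, by omega⟩ : Fin n) 1)
  have hA : A j ≠ 0 := hrows.ne_zero (⟨j.val, hj⟩ : Fin (n - 1))
  rw [evolMul_single_right, evolMul_single_right, evolMul_single_left, hzero, smul_zero,
    smul_zero, map_zero, zero_add] at h
  exact (smul_eq_zero.mp h.symm).resolve_right hA
end
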